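/- Let n ≥ 4 and let t ≥ 0. Suppose that every convex n-gon has an ear whose area is at most t times the area of the n-gon. Then every convex (n+1)-gon has an ear whose area is at most t/(1+t) times the area of the (n+1)-gon. (Equivalently, g_{n+1} ≤ g_n/(1+g_n), where g_n denotes the supremum over convex n-gons of the minimal ear-to-polygon area ratio.) -/

import Mathlib

open MeasureTheory

/-- The area of a planar point set: the Lebesgue measure of its convex hull. -/
noncomputable def area (S : Set (ℝ × ℝ)) : ℝ :=
  (volume (convexHull ℝ S)).toReal

/-- Points in strictly convex position, affinely spanning the plane. -/
def StrictConvexPos {n : ℕ} (p : Fin n → ℝ × ℝ) : Prop :=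
  (∀ i : Fin n, p i ∉ convexHull ℝ (p '' {j | j ≠ i})) ∧
    affineSpan ℝ (Set.range p) = ⊤

/-- The cross product (twice the signed area) of the triangle `a b c`. -/
def Cross (a b c : ℝ × ℝ) : ℝ :=
  (b.1 - a.1) * (c.2 - a.2) - (b.2 - a.2) * (c.1 - a.1)

/-- The vertices `p 0, p 1, …, p (n-1)` are labeled in cyclic order around their
convex hull: all remaining vertices lie strictly on one and the same side of
each directed edge `p i → p (i+1)`. -/
def ConvexCyclic {n : ℕ} [NeZero n] (p : Fin n → ℝ × ℝ) : Prop :=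
  (∀ i j : Fin n, j ≠ i → j ≠ i + 1 → 0 < Cross (p i) (p (i + 1)) (p j)) ∨
  (∀ i j : Fin n, j ≠ i → j ≠ i + 1 → Cross (p i) (p (i + 1)) (p j) < 0)

/-- Reflecting the first coordinate when `s = -1` multiplies the cross product by `s`. -/
lemma cross_scale_fst (s : ℝ) (a b c : ℝ × ℝ) :
    Cross (s * a.1, a.2) (s * b.1, b.2) (s * c.1, c.2) = s * Cross a b c := by
  simp only [Cross]; ring

/-- If every point of a sequence lies to the left of each edge of the open chain it spans, then
all increasing triples are positively oriented. -/
lemma cross_pos_of_chain {m : ℕ} {P : ℕ → ℝ × ℝ}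
    (h : ∀ i j, i + 1 < m → j < m → j ≠ i → j ≠ i + 1 → 0 < Cross (P i) (P (i + 1)) (P j))
    {i j k : ℕ} (hij : i < j) (hjk : j < k) (hk : k < m) :
    0 < Cross (P i) (P j) (P k) := by
  induction k, hjk using Nat.le_induction with
  | base =>
    have := h j i (by lia) (by lia) (by lia) (by lia)
    simp only [Cross] at this ⊢
    linarith
  | succ k hjk ih =>
    have hjk' : 0 < Cross (P i) (P j) (P k) := ih (by lia)
    have hkk : 0 < Cross (P k) (P (k + 1)) (P i) := h k i hk (by lia) (by lia) (by lia)
    have hik : 0 < Cross (P i) (P (i + 1)) (P k) := h i k (by lia) (by lia) (by lia) (by lia)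
    have hik' : 0 < Cross (P i) (P (i + 1)) (P (k + 1)) :=
      h i (k + 1) (by lia) (by lia) (by lia) (by lia)
    rcases eq_or_ne j (i + 1) with rfl | hj
    · exact hik'
    have h1j : 0 < Cross (P i) (P (i + 1)) (P j) := h i j (by lia) (by lia) (by lia) hj
    refine pos_of_mul_pos_right (a := Cross (P i) (P (i + 1)) (P k)) ?_ hik.le
    have plucker : Cross (P i) (P (i + 1)) (P k) * Cross (P i) (P j) (P (k + 1)) =
        Cross (P i) (P (i + 1)) (P j) * Cross (P k) (P (k + 1)) (P i) +
          Cross (P i) (P (i + 1)) (P (k + 1)) * Cross (P i) (P j) (P k) := by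
      simp only [Cross]; ring
    rw [plucker]
    positivity

/-- In a convex pentagon `a b c d e`, the distance of `d` from the line `ab` is at least the
smaller of those of `c` and `e`. -/
lemma min_cross_le_cross {s : ℝ} {a b c d e : ℝ × ℝ}
    (hade : 0 ≤ s * Cross a d e) (hacd : 0 ≤ s * Cross a c d) (hace : 0 < s * Cross a c e)
    (hcde : 0 ≤ s * Cross c d e) (habc : 0 ≤ s * Cross a b c) (habe : 0 ≤ s * Cross a b e) :
    min (s * Cross a b c) (s * Cross a b e) ≤ s * Cross a b d := by
  refine le_of_mul_le_mul_left (a := s * Cross a c e) ?_ hace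
  have key : s * Cross a c e * (s * Cross a b d) =
      s * Cross a d e * (s * Cross a b c) + s * Cross a c d * (s * Cross a b e) := by
    simp only [Cross]; ring
  have hsum : s * Cross a d e + s * Cross a c d = s * Cross c d e + s * Cross a c e := by
    simp only [Cross]; ring
  have hm : 0 ≤ min (s * Cross a b c) (s * Cross a b e) := le_min habc habe
  calc s * Cross a c e * min (s * Cross a b c) (s * Cross a b e)
      ≤ (s * Cross a d e + s * Cross a c d) * min (s * Cross a b c) (s * Cross a b e) :=
        mul_le_mul_of_nonneg_right (by linarith) hm
    _ ≤ s * Cross a c e * (s * Cross a b d) := by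
        rw [key, add_mul]
        exact add_le_add (mul_le_mul_of_nonneg_left (min_le_left _ _) hade)
          (mul_le_mul_of_nonneg_left (min_le_right _ _) hacd)

/-- The linear map sending the standard basis of the plane to `u` and `v`. -/
noncomputable def basisMap (u v : ℝ × ℝ) : (ℝ × ℝ) →ₗ[ℝ] ℝ × ℝ :=
  (LinearMap.fst ℝ ℝ ℝ).smulRight u + (LinearMap.snd ℝ ℝ ℝ).smulRight v

lemma det_basisMap (u v : ℝ × ℝ) : LinearMap.det (basisMap u v) = u.1 * v.2 - u.2 * v.1 := by
  rw [← LinearMap.det_toMatrix (Module.Basis.finTwoProd ℝ), Matrix.det_fin_two]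
  simp [LinearMap.toMatrix_apply, basisMap]
  ring

lemma area_triangle (a b c : ℝ × ℝ) :
    area {a, b, c} = |Cross a b c| * area {((0 : ℝ), (0 : ℝ)), (1, 0), (0, 1)} := by
  have himage : ({a, b, c} : Set (ℝ × ℝ)) =
      (fun x => a + x) '' (basisMap (b - a) (c - a) ''
        {((0 : ℝ), (0 : ℝ)), (1, 0), (0, 1)}) := by
    simp [Set.image_insert_eq, basisMap]
  have htranslate (S : Set (ℝ × ℝ)) :
      convexHull ℝ ((fun x => a + x) '' S) = (fun x => a + x) '' convexHull ℝ S := by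
    simpa [← Set.image_vadd] using convexHull_vadd (𝕜 := ℝ) a S
  unfold area
  rw [himage, htranslate, ← LinearMap.image_convexHull, Set.image_add_left,
    measure_preimage_add, Measure.addHaar_image_linearMap, det_basisMap, ENNReal.toReal_mul,
    ENNReal.toReal_ofReal (abs_nonneg _)]
  rfl

/-- The line through `a` and `b` (the whole plane if `a = b`). -/
def crossLine (a b : ℝ × ℝ) : AffineSubspace ℝ (ℝ × ℝ) where
  carrier := {x | Cross a b x = 0}
  smul_vsub_vadd_mem' := by
    intro r x y z hx hy hz
    simp only [Set.mem_ofPred_eq, Cross, vsub_eq_sub, vadd_eq_add, Prod.fst_add, Prod.snd_add,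
      Prod.smul_fst, Prod.smul_snd, Prod.fst_sub, Prod.snd_sub, smul_eq_mul] at *
    linear_combination r * hx - r * hy + hz

lemma volume_cross_eq_zero {a b c : ℝ × ℝ} (h : Cross a b c ≠ 0) :
    volume {x | Cross a b x = 0} = 0 :=
  Measure.addHaar_affineSubspace volume (crossLine a b) fun htop =>
    h (show c ∈ crossLine a b from htop ▸ AffineSubspace.mem_top ℝ _ c)

lemma convex_mul_cross_nonneg (s : ℝ) (a b : ℝ × ℝ) : Convex ℝ {x | 0 ≤ s * Cross a b x} := by
  intro x hx y hy u v hu hv huv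
  simp only [Set.mem_ofPred_eq] at *
  have : s * Cross a b (u • x + v • y) = u * (s * Cross a b x) + v * (s * Cross a b y) := by
    obtain rfl : v = 1 - u := by linarith
    simp only [Cross, Prod.fst_add, Prod.snd_add, Prod.smul_fst, Prod.smul_snd, smul_eq_mul]
    ring
  rw [this]
  positivity

/-- Areas of point sets on opposite sides of a line are superadditive. -/
lemma area_add_le {S T U : Set (ℝ × ℝ)} (hU : U.Finite) (hSU : S ⊆ U) (hTU : T ⊆ U) {s : ℝ}
    {a b c : ℝ × ℝ} (hc : s * Cross a b c ≠ 0) (hS : ∀ x ∈ S, 0 ≤ s * Cross a b x)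
    (hT : ∀ x ∈ T, s * Cross a b x ≤ 0) : area S + area T ≤ area U := by
  have hs : s ≠ 0 := left_ne_zero_of_mul hc
  have hfin {V : Set (ℝ × ℝ)} (hV : V ⊆ U) : volume (convexHull ℝ V) ≠ ⊤ :=
    ((hU.subset hV).isCompact_convexHull (𝕜 := ℝ)).measure_lt_top.ne
  have hS' : convexHull ℝ S ⊆ {x | 0 ≤ s * Cross a b x} :=
    convexHull_min hS (convex_mul_cross_nonneg s a b)
  have hT' : convexHull ℝ T ⊆ {x | 0 ≤ -s * Cross a b x} :=
    convexHull_min (fun x hx => by simpa using hT x hx) (convex_mul_cross_nonneg (-s) a b)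
  have hdisj : AEDisjoint volume (convexHull ℝ S) (convexHull ℝ T) := by
    refine measure_mono_null (fun x hx => ?_) (volume_cross_eq_zero (right_ne_zero_of_mul hc))
    have h1 := hS' hx.1
    have h2 := hT' hx.2
    simp only [Set.mem_ofPred_eq] at h1 h2 ⊢
    exact (mul_eq_zero.1 (by linarith : s * Cross a b x = 0)).resolve_left hs
  have hTm : NullMeasurableSet (convexHull ℝ T) volume :=
    ((hU.subset hTU).isClosed_convexHull (𝕜 := ℝ)).nullMeasurableSet
  unfold area
  rw [← ENNReal.toReal_add (hfin hSU) (hfin hTU), ← measure_union₀ hTm hdisj]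
  exact ENNReal.toReal_mono (hfin subset_rfl)
    (measure_mono (Set.union_subset (convexHull_mono hSU) (convexHull_mono hTU)))

lemma affineSpan_eq_top_of_cross_ne_zero {S : Set (ℝ × ℝ)} {a b c : ℝ × ℝ} (ha : a ∈ S)
    (hb : b ∈ S) (hc : c ∈ S) (h : Cross a b c ≠ 0) : affineSpan ℝ S = ⊤ := by
  refine eq_top_iff.2 fun x _ => ?_
  have ha' := subset_affineSpan ℝ S ha
  have hab := AffineSubspace.vsub_mem_direction (subset_affineSpan ℝ S hb) ha'
  have hac := AffineSubspace.vsub_mem_direction (subset_affineSpan ℝ S hc) ha'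
  have hx := AffineSubspace.vadd_mem_of_mem_direction
    (Submodule.add_mem _ (Submodule.smul_mem _ (Cross a x c / Cross a b c) hab)
      (Submodule.smul_mem _ (Cross a b x / Cross a b c) hac)) ha'
  convert hx using 1
  ext <;> simp <;> field_simp <;> simp only [Cross] <;> ring

lemma convexCyclic_iff {n : ℕ} [NeZero n] {p : Fin n → ℝ × ℝ} :
    ConvexCyclic p ↔ ∃ s : ℝ, |s| = 1 ∧
      ∀ i j : Fin n, j ≠ i → j ≠ i + 1 → 0 < s * Cross (p i) (p (i + 1)) (p j) := by
  constructor
  · rintro (h | h)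
    · exact ⟨1, by simp, by simpa using h⟩
    · exact ⟨-1, by simp, by simpa using h⟩
  · rintro ⟨s, hs, h⟩
    rcases eq_or_eq_neg_of_abs_eq hs with rfl | rfl
    · exact Or.inl (by simpa using h)
    · exact Or.inr (by simpa using h)

lemma cross_rotate (a b c : ℝ × ℝ) : Cross b c a = Cross a b c := by
  simp only [Cross]; ring

lemma mul_cross_pos_of_lt {n : ℕ} {q : Fin (n + 1) → ℝ × ℝ} {s : ℝ}
    (h : ∀ i j, j ≠ i → j ≠ i + 1 → 0 < s * Cross (q i) (q (i + 1)) (q j))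
    {i j k : Fin (n + 1)} (hij : i < j) (hjk : j < k) : 0 < s * Cross (q i) (q j) (q k) := by
  have key := cross_pos_of_chain (m := n + 1)
    (P := fun l => (s * (q (Fin.ofNat (n + 1) l)).1, (q (Fin.ofNat (n + 1) l)).2))
    (fun a b ha hb hba hba' => by
      rw [cross_scale_fst]
      have hsucc : Fin.ofNat (n + 1) (a + 1) = Fin.ofNat (n + 1) a + 1 := by
        ext; simp [Fin.val_add]
      rw [hsucc]
      refine h _ _ ?_ ?_
      · simp [Fin.ext_iff, Nat.mod_eq_of_lt hb, Nat.mod_eq_of_lt (by lia : a < n + 1), hba]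
      · rw [← hsucc]
        simp [Fin.ext_iff, Nat.mod_eq_of_lt hb, Nat.mod_eq_of_lt ha, hba'])
    (i := i) (j := j) (k := k) hij hjk k.isLt
  rw [cross_scale_fst] at key
  simpa using key

/-- Dropping the last vertex of a convex polygon leaves a convex polygon. -/
lemma convexCyclic_castSucc {n : ℕ} [NeZero n] {q : Fin (n + 1) → ℝ × ℝ}
    (h : ConvexCyclic q) : ConvexCyclic fun i : Fin n => q i.castSucc := by
  obtain ⟨s, hs, h⟩ := convexCyclic_iff.1 h
  refine convexCyclic_iff.2 ⟨s, hs, fun i j hji hji' => ?_⟩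
  by_cases hi : (i : ℕ) + 1 < n
  · have hsucc : (i + 1).castSucc = i.castSucc + 1 := by
      ext
      simp [Fin.val_add, Nat.mod_eq_of_lt hi]
    rw [hsucc]
    refine h _ _ (by simpa using hji) ?_
    rw [← hsucc]
    simpa using hji'
  · have hzero : i + 1 = 0 := by
      ext
      simp [Fin.val_add, (by lia : (i : ℕ) + 1 = n)]
    rw [hzero] at hji' ⊢
    rw [← cross_rotate]
    have hne := Fin.val_ne_of_ne hji
    have hne' := Fin.val_ne_of_ne hji'
    rw [Fin.val_zero] at hne'
    refine mul_cross_pos_of_lt h ?_ ?_ <;> rw [Fin.lt_def] <;> simp <;> lia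

lemma strictConvexPos_castSucc {n : ℕ} (hn : 3 ≤ n) {q : Fin (n + 1) → ℝ × ℝ}
    (hq : StrictConvexPos q) (h : ConvexCyclic q) :
    StrictConvexPos fun i : Fin n => q i.castSucc := by
  refine ⟨fun i hi => hq.1 i.castSucc (convexHull_mono ?_ hi), ?_⟩
  · rintro _ ⟨j, hj, rfl⟩
    exact ⟨j.castSucc, by simpa using hj, rfl⟩
  · obtain ⟨s, -, h⟩ := convexCyclic_iff.1 h
    refine affineSpan_eq_top_of_cross_ne_zero
      ⟨⟨0, by lia⟩, rfl⟩ ⟨⟨1, by lia⟩, rfl⟩ ⟨⟨2, by lia⟩, rfl⟩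
      (right_ne_zero_of_mul (mul_cross_pos_of_lt h ?_ ?_).ne') <;>
    simp [Fin.lt_def]

/-- The ear at the last vertex and the polygon left after dropping it fit inside the polygon. -/
lemma area_castSucc_add_ear_le {n : ℕ} (hn : 3 ≤ n) {q : Fin (n + 1) → ℝ × ℝ}
    (h : ConvexCyclic q) :
    area (Set.range fun i : Fin n => q i.castSucc) +
      area {q (Fin.last n - 1), q (Fin.last n), q (Fin.last n + 1)} ≤ area (Set.range q) := by
  obtain ⟨s, -, h⟩ := convexCyclic_iff.1 h
  have hpred : Fin.last n - 1 = ⟨n - 1, by lia⟩ := by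
    rw [sub_eq_iff_eq_add]; ext; simp [Fin.val_add, (by lia : n - 1 + 1 = n)]
  rw [hpred, Fin.last_add_one]
  have hlast : 0 < s * Cross (q 0) (q ⟨n - 1, by lia⟩) (q (Fin.last n)) :=
    mul_cross_pos_of_lt h (by simp [Fin.lt_def]; lia) (by simp [Fin.lt_def]; lia)
  have hswap (x : ℝ × ℝ) : s * Cross (q ⟨n - 1, by lia⟩) (q 0) x =
      -(s * Cross (q 0) (q ⟨n - 1, by lia⟩) x) := by
    simp only [Cross]; ring
  have hleft (x : ℝ × ℝ) : s * Cross x (q 0) x = 0 := by simp only [Cross]; ring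
  have hright (x : ℝ × ℝ) : s * Cross (q ⟨n - 1, by lia⟩) x x = 0 := by simp only [Cross]; ring
  refine area_add_le (s := s) (a := q ⟨n - 1, by lia⟩) (b := q 0) (c := q (Fin.last n))
    (Set.finite_range q) ?_ ?_ (by rw [hswap]; linarith [hlast]) ?_ ?_
  · rintro _ ⟨i, rfl⟩
    exact ⟨_, rfl⟩
  · rintro _ (rfl | rfl | rfl) <;> exact ⟨_, rfl⟩
  · rintro _ ⟨i, rfl⟩
    dsimp only
    by_cases hi0 : i.castSucc = 0
    · rw [hi0, hright]
    by_cases hi1 : i.castSucc = ⟨n - 1, by lia⟩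
    · rw [hi1, hleft]
    rw [← cross_rotate]
    have h0 := Fin.val_ne_of_ne hi0
    have h1 := Fin.val_ne_of_ne hi1
    simp only [Fin.val_zero, Fin.val_castSucc] at h0 h1
    exact (mul_cross_pos_of_lt h (by simp [Fin.lt_def]; lia) (by simp [Fin.lt_def]; lia)).le
  · rintro _ (rfl | rfl | rfl)
    · exact (hleft _).le
    · rw [hswap]; linarith
    · exact (hright _).le

/-- Every ear of the polygon obtained by dropping the last vertex is at least as large as some
ear of the original polygon. -/
lemma exists_ear_le_ear_castSucc {n : ℕ} [NeZero n] (hn : 4 ≤ n) {q : Fin (n + 1) → ℝ × ℝ}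
    (h : ConvexCyclic q) (i : Fin n) :
    ∃ k : Fin (n + 1), area {q (k - 1), q k, q (k + 1)} ≤
      area {q (i - 1).castSucc, q i.castSucc, q (i + 1).castSucc} := by
  obtain ⟨s, hs, h⟩ := convexCyclic_iff.1 h
  have hstd : 0 ≤ area {((0 : ℝ), (0 : ℝ)), (1, 0), (0, 1)} := ENNReal.toReal_nonneg
  have hle {a b c a' b' c' : ℝ × ℝ} (h0 : 0 ≤ s * Cross a b c)
      (h1 : s * Cross a b c ≤ s * Cross a' b' c') : area {a, b, c} ≤ area {a', b', c'} := by
    rw [area_triangle a, area_triangle a']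
    refine mul_le_mul_of_nonneg_right ?_ hstd
    have h2 := abs_le_abs_of_nonneg h0 h1
    simpa [abs_mul, hs] using h2
  have hpos {a b c : ℕ} (hab : a < b) (hbc : b < c) (hc : c < n + 1) :
      0 < s * Cross (q ⟨a, by lia⟩) (q ⟨b, by lia⟩) (q ⟨c, hc⟩) :=
    mul_cross_pos_of_lt h (by simpa [Fin.lt_def]) (by simpa [Fin.lt_def])
  have hsucc {m a : ℕ} [NeZero m] (ha : a + 1 < m) :
      (⟨a, by lia⟩ : Fin m) + 1 = ⟨a + 1, ha⟩ := by
    ext; simp [Fin.val_add, Nat.mod_eq_of_lt ha]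
  have hpred {m a : ℕ} [NeZero m] (ha : a + 1 < m) :
      (⟨a + 1, ha⟩ : Fin m) - 1 = ⟨a, by lia⟩ := by
    rw [sub_eq_iff_eq_add, hsucc]
  have hwrap {m a : ℕ} [NeZero m] (ha : a < m) (ham : a + 1 = m) :
      (⟨a, ha⟩ : Fin m) + 1 = ⟨0, by lia⟩ := by
    ext; simp [Fin.val_add, ham]
  have hwrap' {m a : ℕ} [NeZero m] (ha : a < m) (ham : a + 1 = m) :
      (⟨0, by lia⟩ : Fin m) - 1 = ⟨a, ha⟩ := by
    rw [sub_eq_iff_eq_add, hwrap ha ham]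
  obtain ⟨n, rfl⟩ : ∃ l, n = l + 4 := ⟨n - 4, by lia⟩
  obtain ⟨_ | i, hi⟩ := i
  · have hmin := min_cross_le_cross (s := s) (a := q ⟨0, by lia⟩) (b := q ⟨1, by lia⟩)
      (c := q ⟨2, by lia⟩) (d := q ⟨n + 3, by lia⟩) (e := q ⟨n + 4, by lia⟩)
      (hpos (by lia) (by lia) _).le (hpos (by lia) (by lia) _).le (hpos (by lia) (by lia) _)
      (hpos (by lia) (by lia) _).le (hpos (by lia) (by lia) _).le (hpos (by lia) (by lia) _).le
    rw [hwrap' (a := n + 3) (by lia) (by lia), hsucc (by lia)]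
    simp only [Fin.castSucc_mk, zero_add]
    rcases min_le_iff.1 hmin with hmin | hmin
    · refine ⟨⟨0 + 1, by lia⟩, ?_⟩
      rw [hpred, hsucc (by lia)]
      refine hle (hpos (by lia) (by lia) _).le (hmin.trans_eq ?_)
      rw [← cross_rotate (q ⟨n + 3, by lia⟩)]
    · refine ⟨⟨0, by lia⟩, ?_⟩
      rw [hwrap' (a := n + 4) (by lia) (by lia), hsucc (by lia)]
      have := hpos (a := 0) (b := 1) (c := n + 4) (by lia) (by lia) (by lia)
      refine hle ?_ ?_
      · rw [← cross_rotate]; exact this.le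
      · rw [← cross_rotate, ← cross_rotate (q ⟨n + 3, by lia⟩)]
        exact hmin
  · rcases Nat.lt_or_ge (i + 2) (n + 4) with hi' | hi'
    · refine ⟨⟨i + 1, by lia⟩, ?_⟩
      rw [hpred, hpred, hsucc (by lia), hsucc (by lia)]
      rfl
    obtain rfl : i = n + 2 := by lia
    have hmin := min_cross_le_cross (s := s) (a := q ⟨n + 2, by lia⟩) (b := q ⟨n + 3, by lia⟩)
      (c := q ⟨n + 4, by lia⟩) (d := q ⟨0, by lia⟩) (e := q ⟨n + 1, by lia⟩)
      (by rw [← cross_rotate]; exact (hpos (by lia) (by lia) _).le)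
      (by rw [cross_rotate]; exact (hpos (by lia) (by lia) _).le)
      (by rw [cross_rotate]; exact hpos (by lia) (by lia) _)
      (by rw [← cross_rotate]; exact (hpos (by lia) (by lia) _).le)
      (hpos (by lia) (by lia) _).le
      (by rw [cross_rotate]; exact (hpos (by lia) (by lia) _).le)
    rw [hpred, hwrap (a := n + 2 + 1) (by lia) (by lia)]
    simp only [Fin.castSucc_mk]
    rcases min_le_iff.1 hmin with hmin | hmin
    · refine ⟨⟨n + 2 + 1, by lia⟩, ?_⟩
      rw [hpred, hsucc (by lia)]
      exact hle (hpos (by lia) (by lia) _).le hmin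
    · refine ⟨⟨n + 1 + 1, by lia⟩, ?_⟩
      rw [hpred, hsucc (by lia)]
      refine hle (hpos (by lia) (by lia) _).le (Eq.trans_le ?_ hmin)
      rw [← cross_rotate]

/-- If every convex `n`-gon (`n ≥ 4`) has an ear of area at most `t` times the area
of the `n`-gon, then every convex `(n+1)`-gon has an ear of area at most `t/(1+t)`
times the area of the `(n+1)`-gon; that is, `g_{n+1} ≤ g_n / (1 + g_n)`. -/
theorem ear_ratio_recursion
    (n : ℕ) [NeZero n] (hn : 4 ≤ n) (t : ℝ) (ht : 0 ≤ t)
    (H : ∀ p : Fin n → ℝ × ℝ, StrictConvexPos p → ConvexCyclic p →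
      ∃ i : Fin n, area {p (i - 1), p i, p (i + 1)} ≤ t * area (Set.range p)) :
    ∀ q : Fin (n + 1) → ℝ × ℝ, StrictConvexPos q → ConvexCyclic q →
      ∃ i : Fin (n + 1),
        area {q (i - 1), q i, q (i + 1)} ≤ t / (1 + t) * area (Set.range q) := by
  intro q hq hc
  obtain ⟨i, hi⟩ := H _ (strictConvexPos_castSucc (by lia) hq hc) (convexCyclic_castSucc hc)
  obtain ⟨k, hk⟩ := exists_ear_le_ear_castSucc hn hc i
  have hadd := area_castSucc_add_ear_le (by lia) hc
  have ht' : 0 < 1 + t := by linarith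
  by_cases hlast : area {q (Fin.last n - 1), q (Fin.last n), q (Fin.last n + 1)} ≤
      t / (1 + t) * area (Set.range q)
  · exact ⟨_, hlast⟩
  refine ⟨k, (hk.trans hi).trans ?_⟩
  have hrest : area (Set.range fun i : Fin n => q i.castSucc) ≤
      area (Set.range q) / (1 + t) := by
    have : area (Set.range q) - t / (1 + t) * area (Set.range q) =
        area (Set.range q) / (1 + t) := by field_simp; ring
    linarith
  calc t * area (Set.range fun i : Fin n => q i.castSucc)
      ≤ t * (area (Set.range q) / (1 + t)) := mul_le_mul_of_nonneg_left hrest ht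
    _ = t / (1 + t) * area (Set.range q) := by ring
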